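/- (Guarantee of the modified-profit greedy sequence, part 2.) Consider an SSFS instance with intersection bonus, finite feasible family F (with ∅ ∈ F), nonnegative profits, and T ≥ 2 time steps. Let (S_1,…,S_T) be any sequence with: S_1 maximizing p_1(S) + |S| over S ∈ F; for 2 ≤ t ≤ T−1, S_t maximizing p_t(S) + |S ∩ S_{t−1}| + |S| over S ∈ F; and S_T maximizing p_T(S) + |S ∩ S_{T−1}| over S ∈ F. Then f(S_1,…,S_T) ≥ Σ_{t=2}^{T−2} |S_t|. -/

import Mathlib

/-- The value of a solution sequence under the intersection bonus: total profit
plus, for each pair of consecutive steps, the size of the intersection of the two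
solutions. -/
noncomputable def intVal (n T : ℕ) (p : ℕ → Finset (Fin n) → ℝ)
    (S : ℕ → Finset (Fin n)) : ℝ :=
  (∑ t ∈ Finset.range T, p t (S t)) +
    ∑ t ∈ Finset.range (T - 1), ((S t ∩ S (t + 1)).card : ℝ)

/-- A valid multistage instance: the empty set is feasible at every time step and
profits are nonnegative. -/
def ValidInstance (n T : ℕ) (F : ℕ → Set (Finset (Fin n)))
    (p : ℕ → Finset (Fin n) → ℝ) : Prop :=
  (∀ t, t < T → (∅ : Finset (Fin n)) ∈ F t) ∧ ∀ t, t < T → ∀ S, 0 ≤ p t S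

/-- A solution sequence: feasible at every time step. -/
def IsSol (n T : ℕ) (F : ℕ → Set (Finset (Fin n))) (S : ℕ → Finset (Fin n)) : Prop :=
  ∀ t, t < T → S t ∈ F t

/-- A deterministic online algorithm: the solution output at time `t < T` depends
only on the data `(F_s, p_s)` revealed up to time `s ≤ t`. -/
def IsOnline (n T : ℕ)
    (alg : (ℕ → Set (Finset (Fin n))) → (ℕ → Finset (Fin n) → ℝ) → ℕ → Finset (Fin n)) :
    Prop :=
  ∀ F p F' p', ∀ t, t < T →
    (∀ s, s ≤ t → F s = F' s ∧ p s = p' s) → alg F p t = alg F' p' t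

/-- The sequences produced by the modified-profit greedy algorithm `MP-Algo`
(time steps are indexed `0, …, T-1`): `S 0` maximizes `p 0 S' + |S'|`; for
`1 ≤ t ≤ T-2`, `S t` maximizes `p t S' + |S' ∩ S (t-1)| + |S'|`; and `S (T-1)`
maximizes `p (T-1) S' + |S' ∩ S (T-2)|`, each over feasible `S'`. -/
def MPGreedy (n T : ℕ) (Feas : Set (Finset (Fin n))) (p : ℕ → Finset (Fin n) → ℝ)
    (S : ℕ → Finset (Fin n)) : Prop :=
  (S 0 ∈ Feas ∧ ∀ S' ∈ Feas,
      p 0 S' + (S'.card : ℝ) ≤ p 0 (S 0) + ((S 0).card : ℝ)) ∧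
  (∀ t, 1 ≤ t → t < T - 1 → S t ∈ Feas ∧ ∀ S' ∈ Feas,
      p t S' + ((S' ∩ S (t - 1)).card : ℝ) + (S'.card : ℝ) ≤
        p t (S t) + ((S t ∩ S (t - 1)).card : ℝ) + ((S t).card : ℝ)) ∧
  (S (T - 1) ∈ Feas ∧ ∀ S' ∈ Feas,
      p (T - 1) S' + ((S' ∩ S (T - 2)).card : ℝ) ≤
        p (T - 1) (S (T - 1)) + ((S (T - 1) ∩ S (T - 2)).card : ℝ))

/-- Comparing each greedy choice with repeating the previous solution, the gains of the first `k`
transitions telescope. -/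
theorem MPGreedy.sum_card_le {n T : ℕ} {Feas : Set (Finset (Fin n))}
    {p : ℕ → Finset (Fin n) → ℝ} {S : ℕ → Finset (Fin n)}
    (hp : ∀ t, t < T → ∀ S, 0 ≤ p t S) (hS : MPGreedy n T Feas p S) (k : ℕ) (hk : k + 2 ≤ T) :
    ∑ t ∈ Finset.range k, ((S t).card : ℝ) + ((S 0).card : ℝ) ≤
      ∑ t ∈ Finset.range k, (p (t + 1) (S (t + 1)) + ((S t ∩ S (t + 1)).card : ℝ)) +
        ((S k).card : ℝ) := by
  obtain ⟨h0, h1, -⟩ := hS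
  induction k with
  | zero => simp
  | succ k ih =>
    have hmem : S k ∈ Feas := by
      rcases Nat.eq_zero_or_pos k with rfl | hpos
      · exact h0.1
      · exact (h1 k hpos (by omega)).1
    have hmax := (h1 (k + 1) (by omega) (by omega)).2 (S k) hmem
    have hnonneg := hp (k + 1) (by omega) (S k)
    rw [Nat.add_sub_cancel, Finset.inter_self, Finset.inter_comm (S (k + 1))] at hmax
    rw [Finset.sum_range_succ, Finset.sum_range_succ]
    linarith [ih (by omega)]

/-- Guarantee of the modified-profit greedy sequence, part 2: for an SSFS instance
with intersection bonus (empty set feasible, nonnegative profits, `T ≥ 2` time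
steps), any sequence `S` satisfying the `MP-Algo` maximization conditions satisfies
`f(S) ≥ ∑_{t=1}^{T-3} |S t|` (time steps indexed from `0`, i.e. the paper's
`∑_{t=2}^{T-2} |S_t|`). -/
theorem stmt15 (n T : ℕ) (hT : 2 ≤ T)
    (Feas : Set (Finset (Fin n))) (hempty : (∅ : Finset (Fin n)) ∈ Feas)
    (p : ℕ → Finset (Fin n) → ℝ) (hp : ∀ t, t < T → ∀ S, 0 ≤ p t S)
    (S : ℕ → Finset (Fin n)) (hS : MPGreedy n T Feas p S) :
    ∑ t ∈ Finset.Icc 1 (T - 3), ((S t).card : ℝ) ≤ intVal n T p S := by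
  obtain ⟨m, rfl⟩ := Nat.exists_eq_add_of_le' hT
  have hsum := hS.sum_card_le hp m le_rfl
  obtain ⟨h0, h1, h2⟩ := hS
  have hmem : S m ∈ Feas := by
    rcases Nat.eq_zero_or_pos m with rfl | hpos
    · exact h0.1
    · exact (h1 m hpos (by omega)).1
  have hlast := h2.2 (S m) hmem
  have hfirst := hp 0 (by omega) (S 0)
  have hnonneg := hp (m + 1) (by omega) (S m)
  have hsub : ∑ t ∈ Finset.Icc 1 (m + 2 - 3), ((S t).card : ℝ) ≤
      ∑ t ∈ Finset.range m, ((S t).card : ℝ) := by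
    refine Finset.sum_le_sum_of_subset_of_nonneg (fun t ht => ?_) fun _ _ _ => Nat.cast_nonneg _
    simp only [Finset.mem_Icc, Finset.mem_range] at ht ⊢
    omega
  have hcard : (0 : ℝ) ≤ ((S 0).card : ℝ) := Nat.cast_nonneg _
  simp only [Nat.add_sub_cancel, show m + 2 - 1 = m + 1 from rfl, Finset.inter_self,
    Finset.inter_comm (S (m + 1))] at hlast
  rw [Finset.sum_add_distrib] at hsum
  rw [intVal, Finset.sum_range_succ', show m + 2 - 1 = m + 1 from rfl, Finset.sum_range_succ,
    Finset.sum_range_succ]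
  linarith
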